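/- arXiv:2501.17750 — 2 statements merged into one kernel-verified Lean document; each statement's English description precedes it below -/
import Mathlib

section
/- Let f : [0,1] → [0,1] be convex, let Ω be a measurable space, and let κ : {0,1}^n → (probability measures on Ω) be a Markov kernel. Fix an index i ∈ {1, …, n} and suppose that for every b_{-i} ∈ {0,1}^{n−1}, the measures κ(b_{-i} with i-th coordinate set to 0) and κ(b_{-i} with i-th coordinate set to 1) are f-indistinguishable. Let w be any probability distribution on {0,1}^{n−1}. Then the mixture measures P_0 = Σ_{b_{-i}} w(b_{-i}) · κ(b_{-i} with i-th coordinate 0) and P_1 = Σ_{b_{-i}} w(b_{-i}) · κ(b_{-i} with i-th coordinate 1) are f-indistinguishable. (This is the statement that, when input bits are independent, the marginal output distribution conditioned on the i-th input bit being 0 versus 1 remains f-indistinguishable.) -/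
open MeasureTheory
open scoped ENNReal NNReal

/-- The trade-off function `T_{P,P'}`: infimum of type II errors over all randomized
tests with type I error at most `α`. -/
noncomputable def tradeOff {Ω : Type*} [MeasurableSpace Ω] (P P' : Measure Ω) (α : ℝ) : ℝ :=
  sInf {β : ℝ | ∃ φ : Ω → ℝ, Measurable φ ∧ (∀ ω, φ ω ∈ Set.Icc (0:ℝ) 1) ∧
    (∫ ω, φ ω ∂P) ≤ α ∧ β = 1 - ∫ ω, φ ω ∂P'}

/-- `P` and `P'` are `f`-indistinguishable. -/
def Indist {Ω : Type*} [MeasurableSpace Ω] (f : ℝ → ℝ) (P P' : Measure Ω) : Prop :=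
  ∀ x ∈ Set.Icc (0:ℝ) 1, f x ≤ tradeOff P P' x

section Indist

variable {Ω : Type*} [MeasurableSpace Ω] {f : ℝ → ℝ} {P P' : Measure Ω}

lemma integrable_of_mem_unitInterval [IsFiniteMeasure P] {φ : Ω → ℝ} (hφ : Measurable φ)
    (hφ01 : ∀ ω, φ ω ∈ Set.Icc (0 : ℝ) 1) : Integrable φ P :=
  .of_mem_Icc 0 1 hφ.aemeasurable (.of_forall hφ01)

lemma integral_mem_unitInterval [IsProbabilityMeasure P] {φ : Ω → ℝ} (hφ : Measurable φ)
    (hφ01 : ∀ ω, φ ω ∈ Set.Icc (0 : ℝ) 1) : ∫ ω, φ ω ∂P ∈ Set.Icc (0 : ℝ) 1 := by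
  refine ⟨integral_nonneg fun ω => (hφ01 ω).1, ?_⟩
  simpa using integral_mono (integrable_of_mem_unitInterval (P := P) hφ hφ01)
    (integrable_const (1 : ℝ)) fun ω => (hφ01 ω).2

/-- The type II error of any test bounds the trade-off function from above. -/
lemma tradeOff_le [IsProbabilityMeasure P'] {φ : Ω → ℝ} {α : ℝ} (hφ : Measurable φ)
    (hφ01 : ∀ ω, φ ω ∈ Set.Icc (0 : ℝ) 1) (hα : ∫ ω, φ ω ∂P ≤ α) :
    tradeOff P P' α ≤ 1 - ∫ ω, φ ω ∂P' := by
  refine csInf_le ⟨0, ?_⟩ ⟨φ, hφ, hφ01, hα, rfl⟩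
  rintro _ ⟨ψ, hψ, hψ01, -, rfl⟩
  exact sub_nonneg.2 (integral_mem_unitInterval hψ hψ01).2

/-- A function lies below the trade-off function at `α ≥ 0` as soon as it lies below all
type II errors. -/
lemma le_tradeOff {α c : ℝ} (hα : 0 ≤ α)
    (h : ∀ φ : Ω → ℝ, Measurable φ → (∀ ω, φ ω ∈ Set.Icc (0 : ℝ) 1) →
      ∫ ω, φ ω ∂P ≤ α → c ≤ 1 - ∫ ω, φ ω ∂P') :
    c ≤ tradeOff P P' α := by
  refine le_csInf ⟨_, fun _ => 0, measurable_const, by simp, by simpa using hα, rfl⟩ ?_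
  rintro _ ⟨φ, hφ, hφ01, hφα, rfl⟩
  exact h φ hφ hφ01 hφα

lemma Indist.apply_one_nonpos [IsProbabilityMeasure P] [IsProbabilityMeasure P']
    (h : Indist f P P') : f 1 ≤ 0 := by
  have := tradeOff_le (P := P) (P' := P') (φ := fun _ => 1) (α := 1) measurable_const
    (by simp) (by simp)
  exact (h 1 (by simp)).trans (by simpa using this)

lemma integral_finsetSum_smul_measure {ι : Type*} (s : Finset ι) (w : ι → ℝ≥0) (μ : ι → Measure Ω)
    {φ : Ω → ℝ} (hφ : ∀ b ∈ s, Integrable φ (μ b)) :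
    ∫ ω, φ ω ∂(∑ b ∈ s, (w b : ℝ≥0∞) • μ b) = ∑ b ∈ s, (w b : ℝ) * ∫ ω, φ ω ∂μ b := by
  rw [integral_finsetSum_measure fun b hb => (hφ b hb).smul_measure ENNReal.coe_ne_top]
  simp [NNReal.smul_def]

/-- For convex `f`, indistinguishability is preserved by finite mixtures. -/
lemma Indist.sum_smul {ι : Type*} [Fintype ι] (hf : ConvexOn ℝ (Set.Icc (0 : ℝ) 1) f)
    {μ ν : ι → Measure Ω} [∀ b, IsProbabilityMeasure (μ b)] [∀ b, IsProbabilityMeasure (ν b)]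
    (h : ∀ b, Indist f (μ b) (ν b)) (w : ι → ℝ≥0) (hw : ∑ b, w b = 1) :
    Indist f (∑ b, (w b : ℝ≥0∞) • μ b) (∑ b, (w b : ℝ≥0∞) • ν b) := by
  have hw' : ∑ b, (w b : ℝ) = 1 := by exact_mod_cast hw
  have : Nonempty ι := by
    by_contra hι
    rw [not_nonempty_iff] at hι
    simp at hw
  intro x hx
  refine le_tradeOff hx.1 fun φ hφ hφ01 hα => ?_
  rw [integral_finsetSum_smul_measure _ _ _ fun b _ =>
    integrable_of_mem_unitInterval hφ hφ01] at hα ⊢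
  have hμ : ∀ b, ∫ ω, φ ω ∂μ b ∈ Set.Icc (0 : ℝ) 1 := fun b => integral_mem_unitInterval hφ hφ01
  have hν : ∀ b, ∫ ω, φ ω ∂ν b ∈ Set.Icc (0 : ℝ) 1 := fun b => integral_mem_unitInterval hφ hφ01
  have hβ : 1 - ∑ b, (w b : ℝ) * ∫ ω, φ ω ∂ν b = ∑ b, (w b : ℝ) * (1 - ∫ ω, φ ω ∂ν b) := by
    simp [mul_sub, hw']
  have hmem : ∑ b, (w b : ℝ) * ∫ ω, φ ω ∂μ b ∈ Set.Icc (0 : ℝ) 1 :=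
    (convex_Icc (0 : ℝ) 1).sum_mem (fun b _ => (w b).2) hw' fun b _ => hμ b
  rw [hβ]
  refine (hf.le_max_of_mem_Icc hmem (by simp) ⟨hα, hx.2⟩).trans (max_le ?_ ?_)
  · refine (hf.map_sum_le (fun b _ => (w b).2) hw' fun b _ => hμ b).trans ?_
    refine Finset.sum_le_sum fun b _ => mul_le_mul_of_nonneg_left ?_ (w b).2
    exact (h b _ (hμ b)).trans (tradeOff_le hφ hφ01 le_rfl)
  · exact (h (Classical.arbitrary ι)).apply_one_nonpos.trans
      (Finset.sum_nonneg fun b _ => mul_nonneg (w b).2 (sub_nonneg.2 (hν b).2))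

end Indist

/-- If for every fixing of the other bits the kernel outputs with i-th bit 0 vs 1 are
`f`-indistinguishable, then so are the marginal mixtures over any distribution `w`
on the other bits. -/
theorem marginal_bit_indist {Ω : Type*} [MeasurableSpace Ω] {n : ℕ}
    (f : ℝ → ℝ) (hf : ConvexOn ℝ (Set.Icc (0:ℝ) 1) f)
    (κ : (Fin (n + 1) → Bool) → Measure Ω)
    (hκ : ∀ b, IsProbabilityMeasure (κ b))
    (i : Fin (n + 1))
    (hcond : ∀ brest : Fin n → Bool,
      Indist f (κ (i.insertNth false brest)) (κ (i.insertNth true brest)))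
    (w : (Fin n → Bool) → ℝ≥0) (hw : ∑ brest, w brest = 1) :
    Indist f (∑ brest, (w brest : ℝ≥0∞) • κ (i.insertNth false brest))
             (∑ brest, (w brest : ℝ≥0∞) • κ (i.insertNth true brest)) :=
  Indist.sum_smul hf hcond w hw
end

section
/- Let f : [0,1] → [0,1] be a trade-off function (convex, nonincreasing, with f(x) ≤ 1 − x for all x). Let (B, B̂) be a pair of {0,1}-valued random variables with P(B = 1) = p ∈ (0,1), P(B̂ = 1 | B = 0) = α, and P(B̂ = 0 | B = 1) = β, and suppose β ≥ f(α) and α + β ≤ 1. Then the mutual information (base 2) satisfies MI(B; B̂) ≤ u_f(p), where u_f(p) = sup_{x ∈ [0,1]} F_f(x, p) and F_f(x, p) = h(p·f(x) + (1−p)(1−x)) − p·h(f(x)) − (1−p)·h(1−x). -/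
open MeasureTheory
open scoped ENNReal

/-- Binary entropy function (base 2), with the convention `h 0 = h 1 = 0`. -/
noncomputable def binH (x : ℝ) : ℝ :=
  -(x * Real.logb 2 x) - (1 - x) * Real.logb 2 (1 - x)

/-- Mutual information (base 2) between two finitely-valued random variables. -/
noncomputable def MI {Ω α β : Type*} [MeasurableSpace Ω] [Fintype α] [Fintype β]
    (P : Measure Ω) (X : Ω → α) (Y : Ω → β) : ℝ :=
  ∑ x : α, ∑ y : β, (P (X ⁻¹' {x} ∩ Y ⁻¹' {y})).toReal *
    Real.logb 2 ((P (X ⁻¹' {x} ∩ Y ⁻¹' {y})).toReal /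
      ((P (X ⁻¹' {x})).toReal * (P (Y ⁻¹' {y})).toReal))

/-- `F_f(x, p) = h(p·f(x) + (1−p)(1−x)) − p·h(f(x)) − (1−p)·h(1−x)`. -/
noncomputable def Ff (f : ℝ → ℝ) (x p : ℝ) : ℝ :=
  binH (p * f x + (1 - p) * (1 - x)) - p * binH (f x) - (1 - p) * binH (1 - x)

/-- `u_f(p) = sup_{x ∈ [0,1]} F_f(x,p)`. -/
noncomputable def uf (f : ℝ → ℝ) (p : ℝ) : ℝ :=
  sSup ((fun x => Ff f x p) '' Set.Icc (0:ℝ) 1)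

theorem binH_eq_binEntropy_div (x : ℝ) : binH x = Real.binEntropy x / Real.log 2 := by
  simp only [binH, Real.logb, Real.binEntropy, Real.log_inv]
  ring

theorem binH_nonneg {x : ℝ} (hx : x ∈ Set.Icc (0 : ℝ) 1) : 0 ≤ binH x := by
  rw [binH_eq_binEntropy_div]
  exact div_nonneg (Real.binEntropy_nonneg hx.1 hx.2) (Real.log_nonneg one_le_two)

theorem binH_le_one (x : ℝ) : binH x ≤ 1 := by
  rw [binH_eq_binEntropy_div]
  exact div_le_one_of_le₀ Real.binEntropy_le_log_two (Real.log_nonneg one_le_two)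

/-- The mutual information of a binary channel with false positive rate `a`, as a function of its
false negative rate `b`, decreases as long as `a + b ≤ 1`. -/
theorem antitoneOn_binEntropy_channel {p a : ℝ} (hp : p ∈ Set.Ioo (0 : ℝ) 1) (ha : 0 ≤ a) :
    AntitoneOn
      (fun b => Real.binEntropy (p * b + (1 - p) * (1 - a)) - p * Real.binEntropy b)
      (Set.Icc 0 (1 - a)) := by
  obtain ⟨hp0, hp1⟩ := hp
  have hderiv : ∀ b ∈ Set.Ioo 0 (1 - a), HasDerivAt
      (fun b => Real.binEntropy (p * b + (1 - p) * (1 - a)) - p * Real.binEntropy b)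
      ((Real.log (1 - (p * b + (1 - p) * (1 - a))) - Real.log (p * b + (1 - p) * (1 - a))) * p
        - p * (Real.log (1 - b) - Real.log b)) b := by
    rintro b ⟨hb0, hb1⟩
    have hq0 : p * b + (1 - p) * (1 - a) ≠ 0 := by nlinarith
    have hq1 : p * b + (1 - p) * (1 - a) ≠ 1 := by nlinarith
    have hin : HasDerivAt (fun b => p * b + (1 - p) * (1 - a)) p b := by
      simpa using ((hasDerivAt_id b).const_mul p).add_const ((1 - p) * (1 - a))
    exact ((Real.hasDerivAt_binEntropy hq0 hq1).comp b hin).sub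
      ((Real.hasDerivAt_binEntropy hb0.ne' (by linarith)).const_mul p)
  refine antitoneOn_of_deriv_nonpos (convex_Icc _ _) ?_ ?_ ?_
  · exact Continuous.continuousOn (by fun_prop)
  · rw [interior_Icc]
    exact fun b hb => (hderiv b hb).differentiableAt.differentiableWithinAt
  · rw [interior_Icc]
    intro b hb
    rw [(hderiv b hb).deriv]
    obtain ⟨hb0, hb1⟩ := hb
    have hle : b ≤ p * b + (1 - p) * (1 - a) := by nlinarith
    have hlt : p * b + (1 - p) * (1 - a) < 1 := by nlinarith
    have h1 := Real.log_le_log hb0 hle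
    have h2 := Real.log_le_log (sub_pos.2 hlt) (sub_le_sub_left hle 1)
    nlinarith

theorem bddAbove_Ff {f : ℝ → ℝ} (hf : ∀ x ∈ Set.Icc (0 : ℝ) 1, f x ∈ Set.Icc (0 : ℝ) 1)
    {p : ℝ} (hp : p ∈ Set.Ioo (0 : ℝ) 1) :
    BddAbove ((fun x => Ff f x p) '' Set.Icc (0 : ℝ) 1) := by
  refine ⟨1, ?_⟩
  rintro _ ⟨x, hx, rfl⟩
  have h1 := binH_le_one (p * f x + (1 - p) * (1 - x))
  have h2 := mul_nonneg hp.1.le (binH_nonneg (hf x hx))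
  have h3 := mul_nonneg (sub_nonneg.2 hp.2.le)
    (binH_nonneg (x := 1 - x) ⟨by linarith [hx.2], by linarith [hx.1]⟩)
  simp only [Ff]
  linarith

theorem mul_logb_mul_div_mul {m s n : ℝ} (hm : m ≠ 0) (hn : s ≠ 0 → n ≠ 0) :
    s * m * Real.logb 2 (s * m / (m * n)) = s * m * (Real.logb 2 s - Real.logb 2 n) := by
  rcases eq_or_ne s 0 with rfl | hs
  · simp
  · rw [mul_comm s m, mul_div_mul_left _ _ hm, Real.logb_div hs (hn hs)]

/-- The mutual information of a pair of bits in terms of the error rates. -/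
theorem MI_eq_binH {Ω : Type*} [MeasurableSpace Ω] (P : Measure Ω) [IsProbabilityMeasure P]
    (B Bhat : Ω → Bool) (hB : Measurable B) (hBhat : Measurable Bhat)
    {p α β : ℝ} (hp : p ∈ Set.Ioo (0 : ℝ) 1)
    (hα0 : 0 ≤ α) (hα1 : α ≤ 1) (hβ0 : 0 ≤ β) (hβ1 : β ≤ 1)
    (hBp : P.real (B ⁻¹' {true}) = p)
    (hα : P.real (B ⁻¹' {false} ∩ Bhat ⁻¹' {true}) = α * (1 - p))
    (hβ : P.real (B ⁻¹' {true} ∩ Bhat ⁻¹' {false}) = β * p) :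
    MI P B Bhat = binH (p * β + (1 - p) * (1 - α)) - p * binH β - (1 - p) * binH (1 - α) := by
  obtain ⟨hp0, hp1⟩ := hp
  have mB : ∀ b, MeasurableSet (B ⁻¹' {b}) := fun b => hB (measurableSet_singleton b)
  have mBh : ∀ b, MeasurableSet (Bhat ⁻¹' {b}) := fun b => hBhat (measurableSet_singleton b)
  have compl : ∀ X : Ω → Bool, X ⁻¹' {false} = (X ⁻¹' {true})ᶜ := fun X => by ext; simp
  have split : ∀ (X : Ω → Bool), Measurable X → ∀ s : Set Ω,
      P.real (s ∩ X ⁻¹' {true}) + P.real (s ∩ X ⁻¹' {false}) = P.real s := fun X hX s => by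
    rw [compl X, ← Set.sdiff_eq]
    exact measureReal_inter_add_sdiff (hX (measurableSet_singleton true))
  have hB0 : P.real (B ⁻¹' {false}) = 1 - p := by
    rw [compl B, probReal_compl_eq_one_sub (mB true), hBp]
  have h11 : P.real (B ⁻¹' {true} ∩ Bhat ⁻¹' {true}) = (1 - β) * p := by
    linarith [split Bhat hBhat (B ⁻¹' {true})]
  have h00 : P.real (B ⁻¹' {false} ∩ Bhat ⁻¹' {false}) = (1 - α) * (1 - p) := by
    linarith [split Bhat hBhat (B ⁻¹' {false})]
  have hn : ∀ b, P.real (Bhat ⁻¹' {b}) =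
      P.real (B ⁻¹' {true} ∩ Bhat ⁻¹' {b}) + P.real (B ⁻¹' {false} ∩ Bhat ⁻¹' {b}) := fun b => by
    rw [← split B hB (Bhat ⁻¹' {b}), Set.inter_comm, Set.inter_comm (B ⁻¹' {false})]
  have hn0 : P.real (Bhat ⁻¹' {false}) = p * β + (1 - p) * (1 - α) := by
    rw [hn, hβ, h00]; ring
  have hn1 : P.real (Bhat ⁻¹' {true}) = 1 - (p * β + (1 - p) * (1 - α)) := by
    rw [hn, h11, hα]; ring
  simp only [MI, Fintype.sum_bool, ← measureReal_def, hBp, hB0, h11, h00, hα, hβ, hn0, hn1]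
  have hp1' : 0 < 1 - p := sub_pos.2 hp1
  have e1 := mul_nonneg hp0.le hβ0
  have e2 := mul_nonneg hp1'.le (sub_nonneg.2 hα1)
  have e3 := mul_nonneg hp0.le (sub_nonneg.2 hβ1)
  have e4 := mul_nonneg hp1'.le hα0
  rw [mul_logb_mul_div_mul hp0.ne', mul_logb_mul_div_mul hp0.ne',
    mul_logb_mul_div_mul hp1'.ne', mul_logb_mul_div_mul hp1'.ne']
  · simp only [binH, sub_sub_cancel]
    ring
  · intro h
    have := mul_pos hp1' (lt_of_le_of_ne (sub_nonneg.2 hα1) h.symm)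
    linarith
  · intro h
    have := mul_pos hp1' (lt_of_le_of_ne hα0 h.symm)
    linarith
  · intro h
    have := mul_pos hp0 (lt_of_le_of_ne hβ0 h.symm)
    linarith
  · intro h
    have := mul_pos hp0 (lt_of_le_of_ne (sub_nonneg.2 hβ1) h.symm)
    linarith

/-- Mutual information upper bound for bit transmission through an `f`-DP channel:
if the false positive/negative rates `(α, β)` respect the trade-off function `f`,
then `MI(B;B̂) ≤ u_f(p)`. -/
theorem mi_le_uf {Ω : Type*} [MeasurableSpace Ω] (P : Measure Ω)
    [IsProbabilityMeasure P]
    (f : ℝ → ℝ) (hf_conv : ConvexOn ℝ (Set.Icc (0:ℝ) 1) f)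
    (hf_anti : AntitoneOn f (Set.Icc (0:ℝ) 1))
    (hf_mem : ∀ x ∈ Set.Icc (0:ℝ) 1, f x ∈ Set.Icc (0:ℝ) 1)
    (hf_le : ∀ x ∈ Set.Icc (0:ℝ) 1, f x ≤ 1 - x)
    (B Bhat : Ω → Bool) (hB : Measurable B) (hBhat : Measurable Bhat)
    (p α β : ℝ) (hp : p ∈ Set.Ioo (0:ℝ) 1)
    (hBp : (P (B ⁻¹' {true})).toReal = p)
    (hα : (P (Bhat ⁻¹' {true} ∩ B ⁻¹' {false})).toReal = α * (1 - p))
    (hβ : (P (Bhat ⁻¹' {false} ∩ B ⁻¹' {true})).toReal = β * p)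
    (htradeoff : f α ≤ β) (hsum : α + β ≤ 1) :
    MI P B Bhat ≤ uf f p := by
  obtain ⟨hp0, hp1⟩ := hp
  have hp1' : 0 < 1 - p := sub_pos.2 hp1
  rw [Set.inter_comm] at hα hβ
  have hα0 : 0 ≤ α := nonneg_of_mul_nonneg_left (hα ▸ ENNReal.toReal_nonneg) hp1'
  have hβ0 : 0 ≤ β := nonneg_of_mul_nonneg_left (hβ ▸ ENNReal.toReal_nonneg) hp0
  have hαI : α ∈ Set.Icc (0 : ℝ) 1 := ⟨hα0, by linarith⟩
  rw [MI_eq_binH P B Bhat hB hBhat ⟨hp0, hp1⟩ hα0 hαI.2 hβ0 (by linarith) hBp hα hβ]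
  refine le_trans ?_ (le_csSup (bddAbove_Ff hf_mem ⟨hp0, hp1⟩) ⟨α, hαI, rfl⟩)
  have key := antitoneOn_binEntropy_channel ⟨hp0, hp1⟩ hα0
    ⟨(hf_mem α hαI).1, hf_le α hαI⟩ ⟨hβ0, by linarith⟩ htradeoff
  have key' := div_le_div_of_nonneg_right key (Real.log_nonneg one_le_two)
  simp only [sub_div, mul_div_assoc, ← binH_eq_binEntropy_div] at key'
  simp only [Ff]
  linarith
end
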